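/- For every non-negative integer n, the hat number of the digraph D_n = K₁ → K₂^{→n} satisfies h(D_n) = 2/3 − (1/6)·4^{−n}. -/

import Mathlib

namespace HatProblem

variable {V : Type*} [Fintype V] [DecidableEq V]

/-- A team strategy: each vertex maps a full configuration to a guess (`none` = pass),
depending only on the colors of its out-neighbors. -/
def IsStrategy (A : V → V → Prop) (S : V → (V → Bool) → Option Bool) : Prop :=
  ∀ (v : V) (c c' : V → Bool), (∀ u, A v u → c u = c' u) → S v c = S v c'

/-- The team wins at configuration `c`: someone guesses correctly, nobody guesses wrong. -/
def Wins (S : V → (V → Bool) → Option Bool) (c : V → Bool) : Prop :=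
  (∃ v, S v c = some (c v)) ∧ ∀ v b, S v c = some b → b = c v

/-- The chance of success of a strategy. -/
noncomputable def chance (S : V → (V → Bool) → Option Bool) : ℚ :=
  ({c : V → Bool | Wins S c}.ncard : ℚ) / 2 ^ Fintype.card V

/-- The hat number of a digraph: the maximal chance of success over all strategies. -/
noncomputable def hatNumber (A : V → V → Prop) : ℚ :=
  haveI : Fintype {S : V → (V → Bool) → Option Bool // IsStrategy A S} :=
    Fintype.ofFinite _
  Finset.sup' (Finset.univ : Finset {S : V → (V → Bool) → Option Bool // IsStrategy A S})
    ⟨⟨fun _ _ => none, fun _ _ _ _ => rfl⟩, Finset.mem_univ _⟩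
    fun S => chance S.1

/-- A clique in the skeleton of a digraph: vertices pairwise joined by arcs both ways. -/
def IsDiClique (A : V → V → Prop) (s : Finset V) : Prop :=
  ∀ x ∈ s, ∀ y ∈ s, x ≠ y → A x y ∧ A y x

/-- The clique number of a digraph: the clique number of its skeleton. -/
noncomputable def cliqueNum (A : V → V → Prop) : ℕ :=
  sSup {n | ∃ s : Finset V, IsDiClique A s ∧ s.card = n}

/-- The directed union `C → D` of two digraphs. -/
def dUnion {W : Type*} (A : V → V → Prop) (B : W → W → Prop) :
    V ⊕ W → V ⊕ W → Prop
  | Sum.inl x, Sum.inl y => A x y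
  | Sum.inl _, Sum.inr _ => True
  | Sum.inr _, Sum.inl _ => False
  | Sum.inr x, Sum.inr y => B x y

/-- The complete digraph on `m` vertices. -/
def completeArc (m : ℕ) : Fin m → Fin m → Prop := fun a b => a ≠ b

end HatProblem

namespace HatProblem

/-- The digraph `Dₙ = K₁ → K₂^{→n}`: vertex `none` is `u`, vertex `some (i, a)` is the
`a`-th vertex of the `i`-th copy of `K₂`. -/
def Dn (n : ℕ) : Option (Fin n × Fin 2) → Option (Fin n × Fin 2) → Prop
  | none, none => False
  | none, some _ => True
  | some _, none => False
  | some p, some q => p.1 < q.1 ∨ (p.1 = q.1 ∧ p.2 ≠ q.2)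

section General

theorem chance_eq_sum {V : Type*} [Fintype V] [DecidableEq V]
    (S : V → (V → Bool) → Option Bool) [DecidablePred (Wins S)] :
    chance S = (∑ c : V → Bool, if Wins S c then (1 : ℚ) else 0) / 2 ^ Fintype.card V := by
  rw [chance, Finset.sum_boole, Set.ncard_eq_toFinset_card']
  simp

theorem chance_le_one {V : Type*} [Fintype V] (S : V → (V → Bool) → Option Bool) :
    chance S ≤ 1 := by
  classical
  rw [chance_eq_sum, div_le_one (by positivity)]
  calc _ ≤ ∑ _c : V → Bool, (1 : ℚ) :=
        Finset.sum_le_sum fun c _ => by split_ifs <;> norm_num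
    _ = _ := by simp

theorem chance_le_hatNumber {V : Type*} [Fintype V] {A : V → V → Prop}
    {S : V → (V → Bool) → Option Bool} (hS : IsStrategy A S) : chance S ≤ hatNumber A := by
  unfold hatNumber
  exact (Finset.le_sup'_iff _).2 ⟨⟨S, hS⟩, @Finset.mem_univ _ (_) _, le_rfl⟩

theorem hatNumber_le {V : Type*} [Fintype V] {A : V → V → Prop} {r : ℚ}
    (h : ∀ S, IsStrategy A S → chance S ≤ r) : hatNumber A ≤ r :=
  Finset.sup'_le _ _ fun S _ => h S.1 S.2

theorem exists_chance_eq_hatNumber {V : Type*} [Fintype V] (A : V → V → Prop) :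
    ∃ S, IsStrategy A S ∧ chance S = hatNumber A := by
  let _ : Fintype {S : V → (V → Bool) → Option Bool // IsStrategy A S} := Fintype.ofFinite _
  obtain ⟨S, -, hS⟩ := Finset.exists_mem_eq_sup'
    (s := (Finset.univ : Finset {S : V → (V → Bool) → Option Bool // IsStrategy A S}))
    ⟨⟨fun _ _ => none, fun _ _ _ _ => rfl⟩, Finset.mem_univ _⟩ fun S => chance S.1
  exact ⟨S.1, S.2, hS.symm⟩

theorem hatNumber_le_one {V : Type*} [Fintype V] (A : V → V → Prop) : hatNumber A ≤ 1 :=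
  hatNumber_le fun S _ => chance_le_one S

theorem hatNumber_le_of_equiv {V W : Type*} [Fintype V] [Fintype W] {A : V → V → Prop}
    {B : W → W → Prop} (e : V ≃ W) (h : ∀ x y, A x y → B (e x) (e y)) :
    hatNumber A ≤ hatNumber B := by
  classical
  refine hatNumber_le fun S hS => ?_
  let T : W → (W → Bool) → Option Bool := fun w c => S (e.symm w) (c ∘ e)
  have hT : IsStrategy B T := fun w c c' hc =>
    hS _ _ _ fun u hu => hc _ (by simpa using h _ _ hu)
  have hwins : ∀ c, Wins S (c ∘ e) ↔ Wins T c := fun c => by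
    simp [Wins, T, e.symm.surjective.exists, e.symm.surjective.forall]
  refine le_of_eq_of_le ?_ (chance_le_hatNumber hT)
  rw [chance_eq_sum, chance_eq_sum, Fintype.card_congr e]
  congr 1
  refine (Fintype.sum_equiv (e.symm.arrowCongr (Equiv.refl Bool)) _ _ fun c => ?_).symm
  have : (e.symm.arrowCongr (Equiv.refl Bool)) c = c ∘ e := by ext; simp
  rw [this, if_congr (hwins c) rfl rfl]

theorem hatNumber_congr {V W : Type*} [Fintype V] [Fintype W] {A : V → V → Prop}
    {B : W → W → Prop} (e : V ≃ W) (h : ∀ x y, A x y ↔ B (e x) (e y)) :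
    hatNumber A = hatNumber B :=
  (hatNumber_le_of_equiv e fun x y => (h x y).1).antisymm
    (hatNumber_le_of_equiv e.symm fun x y hxy => (h _ _).2 (by simpa using hxy))

theorem hatNumber_of_unique {V : Type*} [Fintype V] [Unique V] {A : V → V → Prop}
    (hA : ¬ A default default) : hatNumber A = 1 / 2 := by
  classical
  have key : ∀ S : V → (V → Bool) → Option Bool, chance S =
      ((if S default (fun _ => true) = some true then 1 else 0) +
        (if S default (fun _ => false) = some false then 1 else 0)) / 2 := fun S => by
    rw [chance_eq_sum, Fintype.card_unique, pow_one]
    congr 1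
    rw [← (Equiv.funUnique V Bool).symm.sum_comp, Fintype.sum_bool]
    have hwins : ∀ c, Wins S c ↔ S default c = some (c default) := fun c => by
      rw [Wins, Unique.exists_iff, Unique.forall_iff]
      exact and_iff_left_of_imp fun h b hb => by simpa [h, eq_comm] using hb
    simp only [hwins]
    rfl
  refine le_antisymm (hatNumber_le fun S hS => ?_) ?_
  · have : S default (fun _ => true) = S default (fun _ => false) :=
      hS _ _ _ fun u hu => (hA (by rwa [Unique.eq_default u] at hu)).elim
    rw [key, this]
    rcases S default (fun _ => false) with _ | _ | _ <;> simp
  · have hS : IsStrategy A (fun _ _ => some true) := fun _ _ _ _ => rfl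
    refine le_of_eq_of_le ?_ (chance_le_hatNumber hS)
    rw [key]
    norm_num

end General

section UnionK2

variable {V : Type*} [Fintype V]

/-- The chance of success conditioned on the two vertices of the second summand having
colors `a` and `b`. -/
noncomputable def condChance (S : V ⊕ Fin 2 → (V ⊕ Fin 2 → Bool) → Option Bool)
    (a b : Bool) : ℚ :=
  ({c : V → Bool | Wins S (Sum.elim c ![a, b])}.ncard : ℚ) / 2 ^ Fintype.card V

theorem condChance_eq_sum [DecidableEq V] (S : V ⊕ Fin 2 → (V ⊕ Fin 2 → Bool) → Option Bool)
    [DecidablePred (Wins S)] (a b : Bool) : condChance S a b =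
      (∑ c : V → Bool, if Wins S (Sum.elim c ![a, b]) then (1 : ℚ) else 0) /
        2 ^ Fintype.card V := by
  rw [condChance, Finset.sum_boole, Set.ncard_eq_toFinset_card']
  simp

theorem chance_eq_condChance (S : V ⊕ Fin 2 → (V ⊕ Fin 2 → Bool) → Option Bool) :
    chance S = (condChance S true true + condChance S true false +
      condChance S false true + condChance S false false) / 4 := by
  classical
  let e : (Bool × Bool) × (V → Bool) ≃ (V ⊕ Fin 2 → Bool) :=
    ((Equiv.prodComm _ _).trans ((Equiv.refl _).prodCongr (finTwoArrowEquiv Bool).symm)).trans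
      (Equiv.sumArrowEquivProdArrow V (Fin 2) Bool).symm
  have he : ∀ a b c, e ((a, b), c) = Sum.elim c ![a, b] := fun a b c => by
    ext (v | j)
    · rfl
    · rfl
  rw [chance_eq_sum, ← e.sum_comp, Fintype.sum_prod_type, Fintype.sum_prod_type]
  simp only [Fintype.sum_bool, he, condChance_eq_sum, Fintype.card_sum, Fintype.card_fin, pow_add]
  field_simp
  ring

theorem condChance_le_one (S : V ⊕ Fin 2 → (V ⊕ Fin 2 → Bool) → Option Bool) (a b : Bool) :
    condChance S a b ≤ 1 := by
  classical
  rw [condChance_eq_sum, div_le_one (by positivity)]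
  calc _ ≤ ∑ _c : V → Bool, (1 : ℚ) :=
        Finset.sum_le_sum fun c _ => by split_ifs <;> norm_num
    _ = _ := by simp

theorem condChance_eq_zero {S : V ⊕ Fin 2 → (V ⊕ Fin 2 → Bool) → Option Bool} {a b : Bool}
    (h : ∀ c, ¬ Wins S (Sum.elim c ![a, b])) : condChance S a b = 0 := by
  simp [condChance, h]

theorem condChance_eq_one {S : V ⊕ Fin 2 → (V ⊕ Fin 2 → Bool) → Option Bool} {a b : Bool}
    (h : ∀ c, Wins S (Sum.elim c ![a, b])) : condChance S a b = 1 := by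
  classical
  simp [condChance_eq_sum, h]

theorem condChance_eq_chance {S : V ⊕ Fin 2 → (V ⊕ Fin 2 → Bool) → Option Bool} {a b : Bool}
    {T : V → (V → Bool) → Option Bool} (h : ∀ c, Wins S (Sum.elim c ![a, b]) ↔ Wins T c) :
    condChance S a b = chance T := by
  simp only [condChance, chance, h]

theorem condChance_le_hatNumber {A : V → V → Prop}
    {S : V ⊕ Fin 2 → (V ⊕ Fin 2 → Bool) → Option Bool}
    (hS : IsStrategy (dUnion A (completeArc 2)) S) {a b : Bool}
    (h : ∀ c j, S (Sum.inr j) (Sum.elim c ![a, b]) = none) :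
    condChance S a b ≤ hatNumber A := by
  let T : V → (V → Bool) → Option Bool := fun v c => S (Sum.inl v) (Sum.elim c ![a, b])
  have hT : IsStrategy A T := fun v c c' hc => hS _ _ _ <| by
    rintro (u | j) hu
    · exact hc u hu
    · rfl
  rw [condChance_eq_chance (T := T) fun c => by simp [Wins, h, T]]
  exact chance_le_hatNumber hT

theorem hatNumber_dUnion_le (A : V → V → Prop) :
    hatNumber (dUnion A (completeArc 2)) ≤ max (hatNumber A) ((2 + hatNumber A) / 4) := by
  refine hatNumber_le fun S hS => ?_
  obtain ⟨g₀, hg₀⟩ : ∃ g : Bool → Option Bool,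
      ∀ a b c, S (Sum.inr 0) (Sum.elim c ![a, b]) = g b :=
    ⟨fun b => S (Sum.inr 0) (Sum.elim (fun _ => true) ![true, b]), fun a b c => hS _ _ _ <| by
      rintro (u | j) hu
      · exact hu.elim
      · fin_cases j
        · exact (hu rfl).elim
        · rfl⟩
  obtain ⟨g₁, hg₁⟩ : ∃ g : Bool → Option Bool,
      ∀ a b c, S (Sum.inr 1) (Sum.elim c ![a, b]) = g a :=
    ⟨fun a => S (Sum.inr 1) (Sum.elim (fun _ => true) ![a, true]), fun a b c => hS _ _ _ <| by
      rintro (u | j) hu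
      · exact hu.elim
      · fin_cases j
        · rfl
        · exact (hu rfl).elim⟩
  have hzero₀ : ∀ a b, g₀ b = some (!a) → condChance S a b = 0 := fun a b h =>
    condChance_eq_zero fun c hc => by
      have := hc.2 (Sum.inr 0) (!a) (by rw [hg₀, h])
      simp at this
  have hzero₁ : ∀ a b, g₁ a = some (!b) → condChance S a b = 0 := fun a b h =>
    condChance_eq_zero fun c hc => by
      have := hc.2 (Sum.inr 1) (!b) (by rw [hg₁, h])
      simp at this
  have hpass : ∀ a b, g₀ b = none → g₁ a = none → condChance S a b ≤ hatNumber A :=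
    fun a b h₀ h₁ => condChance_le_hatNumber hS fun c j => by
      fin_cases j
      · exact (hg₀ a b c).trans h₀
      · exact (hg₁ a b c).trans h₁
  have hA := hatNumber_le_one A
  have hone := condChance_le_one S
  have hnonneg : 0 ≤ hatNumber A :=
    le_trans (by rw [chance]; positivity) (chance_le_hatNumber
      (S := fun _ _ => none) fun _ _ _ _ => rfl)
  rw [chance_eq_condChance]
  simp only [Bool.forall_bool, Bool.not_true, Bool.not_false] at hzero₀ hzero₁ hpass hone
  rw [le_max_iff]
  generalize g₀ true = p at *
  generalize g₀ false = q at *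
  generalize g₁ true = r at *
  generalize g₁ false = s at *
  by_cases hall : p = none ∧ q = none ∧ r = none ∧ s = none
  · left
    obtain ⟨rfl, rfl, rfl, rfl⟩ := hall
    simp only [forall_const] at hpass
    linarith [hpass.1.1, hpass.1.2, hpass.2.1, hpass.2.2]
  · right
    obtain ⟨⟨h1, h2⟩, h3, h4⟩ := hone
    rcases p with _ | _ | _ <;> rcases q with _ | _ | _ <;> rcases r with _ | _ | _ <;>
      rcases s with _ | _ | _ <;> simp at hzero₀ hzero₁ hpass hall <;> linarith

theorem le_hatNumber_dUnion (A : V → V → Prop) :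
    (2 + hatNumber A) / 4 ≤ hatNumber (dUnion A (completeArc 2)) := by
  obtain ⟨T, hT, hTA⟩ := exists_chance_eq_hatNumber A
  let S : V ⊕ Fin 2 → (V ⊕ Fin 2 → Bool) → Option Bool := fun x c => match x with
    | Sum.inl v => if c (Sum.inr 0) && c (Sum.inr 1) then T v (c ∘ Sum.inl) else none
    | Sum.inr j => if c (Sum.inr (1 - j)) then none else some true
  have hS : IsStrategy (dUnion A (completeArc 2)) S := by
    rintro (v | j) c c' hc
    · have h := hT v (c ∘ Sum.inl) (c' ∘ Sum.inl) fun u hu => hc (Sum.inl u) hu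
      simp only [S, h, hc (Sum.inr _) trivial]
    · have h : c (Sum.inr (1 - j)) = c' (Sum.inr (1 - j)) :=
        hc _ (by fin_cases j <;> simp [dUnion, completeArc])
      simp only [S, h]
  refine le_of_eq_of_le ?_ (chance_le_hatNumber hS)
  rw [chance_eq_condChance, condChance_eq_chance (T := T), condChance_eq_one, condChance_eq_one,
    condChance_eq_zero, hTA]
  · ring
  all_goals intro c; simp [Wins, S, Fin.forall_fin_two, Fin.exists_fin_two, Sum.elim_comp_inl]

end UnionK2

/-- The vertices of `D_{n+1}` outside the last copy of `K₂` form a copy of `D_n`. -/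
def vertexEquiv (n : ℕ) :
    Option (Fin n × Fin 2) ⊕ Fin 2 ≃ Option (Fin (n + 1) × Fin 2) where
  toFun := Sum.elim (Option.map fun p => (p.1.castSucc, p.2)) fun j => some (Fin.last n, j)
  invFun x := match x with
    | none => Sum.inl none
    | some (i, j) => Fin.lastCases (Sum.inr j) (fun i => Sum.inl (some (i, j))) i
  left_inv := by rintro ((_ | ⟨i, j⟩) | j) <;> simp
  right_inv := by
    rintro (_ | ⟨i, j⟩)
    · rfl
    · induction i using Fin.lastCases <;> simp

theorem hatNumber_Dn_succ (n : ℕ) :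
    hatNumber (Dn (n + 1)) = hatNumber (dUnion (Dn n) (completeArc 2)) := by
  refine (hatNumber_congr (vertexEquiv n) ?_).symm
  rintro ((_ | ⟨i, j⟩) | j) ((_ | ⟨i', j'⟩) | j') <;>
    simp [vertexEquiv, dUnion, Dn, completeArc, Fin.castSucc_lt_last,
      (Fin.castSucc_lt_last _).le, (Fin.castSucc_lt_last _).ne']

/-- For every non-negative integer `n` we have `h(Dₙ) = 2/3 - (1/6)·4^{-n}`. -/
theorem hatNumber_Dn (n : ℕ) :
    hatNumber (Dn n) = 2 / 3 - (1 / 6) * (1 / 4 : ℚ) ^ n := by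
  induction n with
  | zero =>
    rw [hatNumber_of_unique (V := Option (Fin 0 × Fin 2)) id]
    norm_num
  | succ n ih =>
    have hle := hatNumber_dUnion_le (Dn n)
    have hge := le_hatNumber_dUnion (Dn n)
    have hpow : (0 : ℚ) < (1 / 4) ^ n := by positivity
    rw [ih] at hle hge
    rw [max_eq_right (by linarith)] at hle
    rw [hatNumber_Dn_succ, pow_succ]
    linarith

end HatProblem
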